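/- Assume hypotheses H1 and H2 and let f : ℝ^N → ℝ be a C^N-function. For p ≥ 1 and x ∈ ℝ^N, the family (□f(γ^{i_1} ∘ ⋯ ∘ γ^{i_p}(0), γ^{i_1} ∘ ⋯ ∘ γ^{i_p}(x)))_{(i_1,…,i_p) ∈ I^p} is absolutely summable; denote its sum by 𝕄^p f(x). Then |𝕄^p f(x) − (1/μ(T)) (∫_T ∂_N f dμ) ∏_{n∈N} x_n| ≤ 2 (∏_{n∈N} |x_n|) · ω_T(∂_N f, r_x q^p), where r_x = max(diam T, ‖x‖) (Euclidean norm and diameter in ℝ^N) and ω_T(g, δ) = sup{|g(u) − g(v)| : u ∈ T, v ∈ ℝ^N, ‖u − v‖ < δ}. -/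

import Mathlib

open MeasureTheory

/-- The multidimensional increment `□f(x,y) = ∑_{M ⊆ N} (−1)^{|M|} f(π_M(x,y))`,
where `π_M(x,y)(n) = x n` if `n ∈ M` and `y n` otherwise. -/
noncomputable def mwBoxIncr {N : Type*} [Fintype N] [DecidableEq N] {α : Type*}
    (f : (N → α) → ℝ) (x y : N → α) : ℝ :=
  ∑ M : Finset N, (-1 : ℝ) ^ M.card * f (fun n => if n ∈ M then x n else y n)

/-- The multidimensional increment for grouped coordinates `V^N = ℝ^{N×K}`:
subsets `M` range over the first factor only. -/
noncomputable def mwBoxIncrG {r s : ℕ} (f : (Fin r × Fin s → ℝ) → ℝ)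
    (x y : Fin r × Fin s → ℝ) : ℝ :=
  ∑ M : Finset (Fin r), (-1 : ℝ) ^ M.card * f (fun l => if l.1 ∈ M then x l else y l)

/-- Partial derivative of `f` in the coordinate `l`. -/
noncomputable def mwPD {ι : Type*} [DecidableEq ι] (l : ι) (f : (ι → ℝ) → ℝ) :
    (ι → ℝ) → ℝ :=
  fun x => deriv (fun t => f (Function.update x l t)) (x l)

/-- Iterated partial derivative along a list of coordinates (leftmost applied last). -/
noncomputable def mwIterPD {ι : Type*} [DecidableEq ι] (ls : List ι)
    (f : (ι → ℝ) → ℝ) : (ι → ℝ) → ℝ :=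
  ls.foldr mwPD f

/-- Existence (everywhere) of the iterated partial derivative along a list. -/
def mwExistsIterPD {ι : Type*} [DecidableEq ι] : List ι → ((ι → ℝ) → ℝ) → Prop
  | [], _ => True
  | l :: ls, f => mwExistsIterPD ls f ∧
      ∀ x, DifferentiableAt ℝ (fun t => mwIterPD ls f (Function.update x l t)) (x l)

/-- `f : ℝ^N → ℝ` is a `C^N`-function (case `s = 1`): for every `M ⊆ N`, `∂_M f`
exists everywhere and is continuous. -/
def mwIsCN {r : ℕ} (f : (Fin r → ℝ) → ℝ) : Prop :=
  ∀ M : Finset (Fin r),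
    mwExistsIterPD (M.sort (· ≤ ·)) f ∧ Continuous (mwIterPD (M.sort (· ≤ ·)) f)

/-- `∂_N f = ∂_1 ⋯ ∂_r f`. -/
noncomputable def mwDN {r : ℕ} (f : (Fin r → ℝ) → ℝ) : (Fin r → ℝ) → ℝ :=
  mwIterPD ((Finset.univ : Finset (Fin r)).sort (· ≤ ·)) f

/-- `f : V^N → ℝ` (with `V = ℝ^K`) is a `C^N`-function: for every `M ⊆ N` and
`k ∈ K^M`, the iterated partial derivative `∂̃_k f` exists everywhere and is continuous. -/
def mwIsCNG {r s : ℕ} (f : (Fin r × Fin s → ℝ) → ℝ) : Prop :=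
  ∀ (M : Finset (Fin r)) (k : Fin r → Fin s),
    mwExistsIterPD ((M.sort (· ≤ ·)).map (fun m => (m, k m))) f ∧
    Continuous (mwIterPD ((M.sort (· ≤ ·)).map (fun m => (m, k m))) f)

/-- `γ^{i_1} ∘ ⋯ ∘ γ^{i_p}` for a multi-index `i ∈ I^p`. -/
def mwComp {I β : Type*} (γ : I → β → β) {p : ℕ} (i : Fin p → I) : β → β :=
  (List.ofFn i).foldr (fun j g => γ j ∘ g) id

/-- `Q(a,b) = ∏_{n} [a_n, b_n)`. -/
def mwQ {r : ℕ} (a b : Fin r → ℝ) : Set (Fin r → ℝ) :=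
  {z | ∀ n, a n ≤ z n ∧ z n < b n}

/-- `Π(x,y) = ∏_n {x_n, y_n}`. -/
def mwPi {N α : Type*} (x y : N → α) : Set (N → α) :=
  {z | ∀ n, z n = x n ∨ z n = y n}

/-- `Π(x,y) = ∏_n {x_n, y_n}` for grouped coordinates, `x_n ∈ V = ℝ^K`. -/
def mwPiG {r s : ℕ} (x y : Fin r × Fin s → ℝ) : Set (Fin r × Fin s → ℝ) :=
  {z | ∀ n : Fin r, (∀ k, z (n, k) = x (n, k)) ∨ (∀ k, z (n, k) = y (n, k))}

/-- Euclidean norm on `ℝ^N`. -/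
noncomputable def mwNorm {r : ℕ} (x : Fin r → ℝ) : ℝ := Real.sqrt (∑ n, x n ^ 2)

/-- Euclidean diameter of a subset of `ℝ^N`. -/
noncomputable def mwDiam {r : ℕ} (T : Set (Fin r → ℝ)) : ℝ :=
  sSup {d | ∃ u ∈ T, ∃ v ∈ T, d = mwNorm (u - v)}

/-- `ω_T(g,δ) = sup {|g(u) − g(v)| : u ∈ T, ‖u − v‖ < δ}`. -/
noncomputable def mwOmega {r : ℕ} (T : Set (Fin r → ℝ)) (g : (Fin r → ℝ) → ℝ)
    (δ : ℝ) : ℝ :=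
  sSup {d | ∃ u ∈ T, ∃ v, mwNorm (u - v) < δ ∧ d = |g u - g v|}

/-- `𝕄^p f(x) = ∑_{i ∈ I^p} □f(γ^i(0), γ^i(x))`. -/
noncomputable def mwMWp {r : ℕ} {I : Type*} (γ : I → (Fin r → ℝ) → (Fin r → ℝ))
    (f : (Fin r → ℝ) → ℝ) (p : ℕ) (x : Fin r → ℝ) : ℝ :=
  ∑' i : Fin p → I, mwBoxIncr f (mwComp γ i 0) (mwComp γ i x)

/-- Iterates of the MW-operator: `𝕄^0 f = f`,
`𝕄^{k+1} f(x) = ∑_{i ∈ I} □(𝕄^k f)(γ^i(0), γ^i(x))`. -/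
noncomputable def mwMWiter {N α I : Type*} [Fintype N] [DecidableEq N] [Zero α]
    (γ : I → (N → α) → (N → α)) (f : (N → α) → ℝ) : ℕ → ((N → α) → ℝ)
  | 0 => f
  | k + 1 => fun x => ∑' i : I, mwBoxIncr (mwMWiter γ f k) (γ i 0) (γ i x)

/-- The alternating sum over `M ⊆ S`: coordinates in `S` are taken from `x` or `y`,
the others are frozen at `z`. -/
noncomputable def partialBoxIncr {N : Type*} [DecidableEq N] (f : (N → ℝ) → ℝ)
    (x y : N → ℝ) (S : Finset N) (z : N → ℝ) : ℝ :=
  ∑ M ∈ S.powerset, (-1 : ℝ) ^ M.card *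
    f (fun n => if n ∈ M then x n else if n ∈ S then y n else z n)

theorem partialBoxIncr_insert {N : Type*} [DecidableEq N] (f : (N → ℝ) → ℝ)
    (x y : N → ℝ) {S : Finset N} {l : N} (hl : l ∉ S) (z : N → ℝ) :
    partialBoxIncr f x y (insert l S) z =
      partialBoxIncr f x y S (Function.update z l (y l)) -
        partialBoxIncr f x y S (Function.update z l (x l)) := by
  unfold partialBoxIncr
  rw [Finset.sum_powerset_insert hl, sub_eq_add_neg, ← Finset.sum_neg_distrib]
  congr 1
  · refine Finset.sum_congr rfl fun M hM => ?_
    have hlM : l ∉ M := fun h => hl (Finset.mem_powerset.1 hM h)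
    congr 2
    funext n
    by_cases hn : n = l
    · subst hn; simp [hlM, hl]
    · simp [hn]
  · refine Finset.sum_congr rfl fun M hM => ?_
    have hlM : l ∉ M := fun h => hl (Finset.mem_powerset.1 hM h)
    rw [Finset.card_insert_of_notMem hlM, pow_succ, mul_neg_one, neg_mul]
    congr 3
    funext n
    by_cases hn : n = l
    · subst hn; simp [hlM, hl]
    · simp [hn]

theorem hasDerivAt_partialBoxIncr {N : Type*} [DecidableEq N] {f : (N → ℝ) → ℝ} {l : N}
    (hf : ∀ x, DifferentiableAt ℝ (fun t => f (Function.update x l t)) (x l))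
    (x y : N → ℝ) {S : Finset N} (hl : l ∉ S) (z : N → ℝ) (t : ℝ) :
    HasDerivAt (fun t => partialBoxIncr f x y S (Function.update z l t))
      (partialBoxIncr (mwPD l f) x y S (Function.update z l t)) t := by
  unfold partialBoxIncr
  refine HasDerivAt.fun_sum fun M hM => HasDerivAt.const_mul _ ?_
  have hlM : l ∉ M := fun h => hl (Finset.mem_powerset.1 hM h)
  set w : N → ℝ := fun n => if n ∈ M then x n else if n ∈ S then y n else z n
  have hw : ∀ s, (fun n => if n ∈ M then x n else if n ∈ S then y n
      else Function.update z l s n) = Function.update w l s := by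
    intro s
    funext n
    by_cases hn : n = l
    · subst hn; simp [hlM, hl]
    · simp [hn, w]
  simp only [hw]
  have h := (hf (Function.update w l t)).hasDerivAt
  simp only [Function.update_idem, Function.update_self] at h
  simpa [mwPD] using h

theorem mwExistsIterPD_append_singleton {N : Type*} [DecidableEq N] (ls : List N) (l : N)
    (f : (N → ℝ) → ℝ) (h : mwExistsIterPD (ls ++ [l]) f) :
    (∀ x, DifferentiableAt ℝ (fun t => f (Function.update x l t)) (x l)) ∧
      mwExistsIterPD ls (mwPD l f) := by
  induction ls with
  | nil => exact ⟨h.2, trivial⟩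
  | cons m ls ih =>
    obtain ⟨h₁, h₂⟩ := h
    refine ⟨(ih h₁).1, (ih h₁).2, ?_⟩
    simpa [mwIterPD, List.foldr_append] using h₂

theorem exists_mul_eq_sub_of_hasDerivAt {F F' : ℝ → ℝ} (hF : ∀ t, HasDerivAt F (F' t) t)
    (u v : ℝ) : ∃ τ ∈ Set.uIcc u v, F v - F u = (v - u) * F' τ := by
  have key : ∀ u v : ℝ, u < v → ∃ τ ∈ Set.uIcc u v, F v - F u = (v - u) * F' τ := by
    intro u v huv
    obtain ⟨τ, hτ, h⟩ := exists_hasDerivAt_eq_slope F F' huv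
      (fun t _ => (hF t).continuousAt.continuousWithinAt) (fun t _ => hF t)
    refine ⟨τ, Set.Icc_subset_uIcc (Set.Ioo_subset_Icc_self hτ), ?_⟩
    rw [h, mul_div_cancel₀]
    exact (sub_pos.2 huv).ne'
  rcases lt_trichotomy u v with h | rfl | h
  · exact key u v h
  · exact ⟨u, Set.left_mem_uIcc, by simp⟩
  · obtain ⟨τ, hτ, e⟩ := key v u h
    exact ⟨τ, Set.uIcc_comm v u ▸ hτ, by linarith⟩

/-- Mean value theorem for the increment in the coordinates of a list. -/
theorem exists_partialBoxIncr_eq {N : Type*} [DecidableEq N] (x y : N → ℝ) (ls : List N)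
    (hls : ls.Nodup) (f : (N → ℝ) → ℝ) (hf : mwExistsIterPD ls f) (z : N → ℝ) :
    ∃ ξ : N → ℝ, (∀ n ∈ ls, ξ n ∈ Set.uIcc (x n) (y n)) ∧ (∀ n ∉ ls, ξ n = z n) ∧
      partialBoxIncr f x y ls.toFinset z =
        (∏ n ∈ ls.toFinset, (y n - x n)) * mwIterPD ls f ξ := by
  induction ls using List.reverseRecOn generalizing f z with
  | nil => exact ⟨z, by simp, by simp, by simp [partialBoxIncr, mwIterPD]⟩
  | append_singleton ls l ih =>
    obtain ⟨hd, hex⟩ := mwExistsIterPD_append_singleton ls l f hf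
    have hl : l ∉ ls := by
      intro h
      have := List.disjoint_of_nodup_append hls h
      simp at this
    have hlS : l ∉ ls.toFinset := by simpa using hl
    obtain ⟨τ, hτ, e⟩ := exists_mul_eq_sub_of_hasDerivAt
      (hasDerivAt_partialBoxIncr hd x y hlS z) (x l) (y l)
    obtain ⟨ξ, h₁, h₂, h₃⟩ := ih (List.Nodup.of_append_left hls) (mwPD l f) hex
      (Function.update z l τ)
    have hS : (ls ++ [l]).toFinset = insert l ls.toFinset := by
      ext n; simp
    refine ⟨ξ, ?_, ?_, ?_⟩
    · intro n hn
      by_cases hnl : n ∈ ls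
      · exact h₁ n hnl
      · obtain rfl : n = l := by simpa [hnl] using hn
        rw [h₂ n hnl, Function.update_self]
        exact hτ
    · intro n hn
      rw [List.mem_append, not_or, List.mem_singleton] at hn
      rw [h₂ n hn.1, Function.update_of_ne hn.2]
    · rw [hS, partialBoxIncr_insert f x y hlS, e, h₃, Finset.prod_insert hlS, mul_assoc]
      simp [mwIterPD, List.foldr_append]

/-- Mean value theorem for the multidimensional increment. -/
theorem exists_mwBoxIncr_eq {r : ℕ} {f : (Fin r → ℝ) → ℝ}
    (hf : mwExistsIterPD ((Finset.univ : Finset (Fin r)).sort (· ≤ ·)) f)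
    (x y : Fin r → ℝ) :
    ∃ ξ : Fin r → ℝ, (∀ n, ξ n ∈ Set.uIcc (x n) (y n)) ∧
      mwBoxIncr f x y = (∏ n, (y n - x n)) * mwDN f ξ := by
  obtain ⟨ξ, h₁, -, h₃⟩ := exists_partialBoxIncr_eq x y _ (Finset.sort_nodup _ _) f hf 0
  refine ⟨ξ, fun n => h₁ n (by simp), ?_⟩
  rw [Finset.sort_toFinset] at h₃
  rw [mwDN, ← h₃]
  simp [mwBoxIncr, partialBoxIncr]

theorem abs_le_mwNorm {r : ℕ} (v : Fin r → ℝ) (n : Fin r) : |v n| ≤ mwNorm v := by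
  rw [mwNorm, ← Real.sqrt_sq_eq_abs]
  exact Real.sqrt_le_sqrt
    (Finset.single_le_sum (f := fun n => v n ^ 2) (fun _ _ => sq_nonneg _) (Finset.mem_univ n))

theorem mwNorm_le_mul {r : ℕ} {u v : Fin r → ℝ} {c : ℝ} (hc : 0 ≤ c)
    (h : ∀ n, |u n| ≤ c * |v n|) : mwNorm u ≤ c * mwNorm v := by
  unfold mwNorm
  rw [← Real.sqrt_sq hc, ← Real.sqrt_mul (sq_nonneg c), Finset.mul_sum]
  refine Real.sqrt_le_sqrt (Finset.sum_le_sum fun n _ => ?_)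
  rw [← mul_pow]
  refine sq_le_sq.2 ?_
  rw [abs_mul, abs_of_nonneg hc]
  exact h n

theorem continuous_mwNorm {r : ℕ} : Continuous (mwNorm : (Fin r → ℝ) → ℝ) := by
  unfold mwNorm
  fun_prop

theorem mwNorm_sub_le_mwDiam {r : ℕ} {T : Set (Fin r → ℝ)} (hT : IsCompact T)
    {u v : Fin r → ℝ} (hu : u ∈ T) (hv : v ∈ T) : mwNorm (u - v) ≤ mwDiam T := by
  refine le_csSup ?_ ⟨u, hu, v, hv, rfl⟩
  have hc : Continuous fun w : (Fin r → ℝ) × (Fin r → ℝ) => mwNorm (w.1 - w.2) :=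
    continuous_mwNorm.comp (by fun_prop)
  refine ((hT.prod hT).image hc).bddAbove.mono ?_
  rintro _ ⟨u, hu, v, hv, rfl⟩
  exact ⟨(u, v), ⟨hu, hv⟩, rfl⟩

theorem mwDiam_pos {r : ℕ} (hr : 0 < r) {T : Set (Fin r → ℝ)} (hT : IsCompact T)
    (hpos : 0 < volume T) : 0 < mwDiam T := by
  have : Nonempty (Fin r) := ⟨⟨0, hr⟩⟩
  have hns : ¬ T.Subsingleton := fun h => hpos.ne' (h.measure_zero volume)
  obtain ⟨u, hu, v, hv, huv⟩ := Set.not_subsingleton_iff.1 hns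
  obtain ⟨n, hn⟩ := Function.ne_iff.1 huv
  refine lt_of_lt_of_le ?_ (mwNorm_sub_le_mwDiam hT hu hv)
  exact lt_of_lt_of_le (abs_pos.2 (sub_ne_zero.2 hn)) (abs_le_mwNorm (u - v) n)

theorem isCompact_mwNorm_le {r : ℕ} (δ : ℝ) : IsCompact {w : Fin r → ℝ | mwNorm w ≤ δ} := by
  refine (isCompact_closedBall (0 : Fin r → ℝ) (max δ 0)).of_isClosed_subset
    (isClosed_le continuous_mwNorm continuous_const) fun w hw => ?_
  rw [mem_closedBall_zero_iff, pi_norm_le_iff_of_nonneg (le_max_right _ _)]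
  exact fun n => (abs_le_mwNorm w n).trans (le_max_of_le_left hw)

theorem abs_sub_le_mwOmega {r : ℕ} {T : Set (Fin r → ℝ)} (hT : IsCompact T)
    {g : (Fin r → ℝ) → ℝ} (hg : Continuous g) {δ : ℝ} (hδ : 0 < δ)
    {u v : Fin r → ℝ} (hu : u ∈ T) (huv : mwNorm (u - v) ≤ δ) :
    |g u - g v| ≤ mwOmega T g δ := by
  have hbdd : BddAbove {d | ∃ u ∈ T, ∃ v, mwNorm (u - v) < δ ∧ d = |g u - g v|} := by
    have hc : Continuous fun w : (Fin r → ℝ) × (Fin r → ℝ) => |g w.1 - g (w.1 - w.2)| := by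
      fun_prop
    refine ((hT.prod (isCompact_mwNorm_le δ)).image hc).bddAbove.mono ?_
    rintro _ ⟨u, hu, v, hv, rfl⟩
    exact ⟨(u, u - v), ⟨hu, hv.le⟩, by simp⟩
  have hlim : Filter.Tendsto (fun s : ℝ => |g u - g (u - s • (u - v))|)
      (nhdsWithin 1 (Set.Iio 1)) (nhds |g u - g v|) := by
    have hc : Continuous fun s : ℝ => |g u - g (u - s • (u - v))| := by fun_prop
    simpa using (hc.tendsto 1).mono_left nhdsWithin_le_nhds
  refine le_of_tendsto hlim ?_
  filter_upwards [Ioo_mem_nhdsLT (zero_lt_one : (0 : ℝ) < 1)] with s hs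
  refine le_csSup hbdd ⟨u, hu, u - s • (u - v), ?_, rfl⟩
  have h : mwNorm (u - (u - s • (u - v))) ≤ s * mwNorm (u - v) := by
    refine mwNorm_le_mul hs.1.le fun n => ?_
    simp [abs_mul, abs_of_pos hs.1]
  nlinarith [hs.1, hs.2, mul_le_mul_of_nonneg_left huv hs.1.le]

theorem mwComp_cons {I β : Type*} (γ : I → β → β) {p : ℕ} (j : I) (i : Fin p → I) :
    mwComp γ (Fin.cons j i) = γ j ∘ mwComp γ i := by
  simp [mwComp, List.ofFn_succ]

theorem mwComp_mem {I β : Type*} {γ : I → β → β} {T : Set β} (h : ∀ i, ∀ x ∈ T, γ i x ∈ T)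
    {p : ℕ} (i : Fin p → I) {x : β} (hx : x ∈ T) : mwComp γ i x ∈ T := by
  induction p with
  | zero => simpa [mwComp] using hx
  | succ p ih =>
    rw [← Fin.cons_self_tail i, mwComp_cons]
    exact h _ _ (ih _)

theorem mwComp_apply {r : ℕ} {I : Type*} {α a : I → Fin r → ℝ}
    {γ : I → (Fin r → ℝ) → (Fin r → ℝ)} (hγ : ∀ i x n, γ i x n = α i n * x n + a i n)
    {p : ℕ} (i : Fin p → I) (x : Fin r → ℝ) (n : Fin r) :
    mwComp γ i x n = (∏ k, α (i k) n) * x n + mwComp γ i 0 n := by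
  induction p with
  | zero => simp [mwComp]
  | succ p ih =>
    have hx : ∀ x n, mwComp γ i x n = α (i 0) n * mwComp γ (Fin.tail i) x n + a (i 0) n := by
      intro x n
      conv_lhs => rw [← Fin.cons_self_tail i, mwComp_cons]
      exact hγ _ _ _
    rw [hx, hx 0, ih (Fin.tail i), Fin.prod_univ_succ]
    simp only [Fin.tail]
    ring

theorem setIntegral_image_affine {r : ℕ} (α a : Fin r → ℝ) (hα : ∀ n, 0 < α n)
    {φ : (Fin r → ℝ) → (Fin r → ℝ)} (hφ : ∀ x n, φ x n = α n * x n + a n)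
    {T : Set (Fin r → ℝ)} (hT : MeasurableSet T) (h : (Fin r → ℝ) → ℝ) :
    ∫ t in φ '' T, h t = (∏ n, α n) * ∫ t in T, h (φ t) := by
  let L : (Fin r → ℝ) →L[ℝ] (Fin r → ℝ) :=
    LinearMap.toContinuousLinearMap (Matrix.toLin' (Matrix.diagonal α))
  have hdet : L.det = ∏ n, α n := by
    simp [L, ContinuousLinearMap.det, LinearMap.det_toLin', Matrix.det_diagonal]
  have hφL : φ = fun x => L x + a := by
    funext x n
    simp [L, hφ, Matrix.mulVec_diagonal]
  have hinj : Function.Injective φ := by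
    intro x y hxy
    funext n
    have := congrFun hxy n
    rw [hφ, hφ] at this
    exact mul_left_cancel₀ (hα n).ne' (add_right_cancel this)
  rw [integral_image_eq_integral_abs_det_fderiv_smul volume hT (f' := fun _ => L)
    (fun x _ => by rw [hφL]; exact (L.hasFDerivAt.add_const a).hasFDerivWithinAt)
    hinj.injOn, hdet, abs_of_pos (Finset.prod_pos fun n _ => hα n)]
  simp only [smul_eq_mul, integral_const_mul]

/-- Self-similarity of the integral over `T` under the `p`-fold compositions. -/
theorem hasSum_setIntegral_mwComp {r : ℕ} {I : Type*} {α : I → Fin r → ℝ}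
    {γ : I → (Fin r → ℝ) → (Fin r → ℝ)} (hα : ∀ i n, 0 < α i n)
    (hγc : ∀ i, Continuous (γ i)) {T : Set (Fin r → ℝ)} (hTc : IsCompact T)
    (hTpos : 0 < volume T) (hmaps : ∀ i, ∀ x ∈ T, γ i x ∈ T)
    (hstep : ∀ h : (Fin r → ℝ) → ℝ, Continuous h →
      HasSum (fun i => (∏ n, α i n) * ∫ t in T, h (γ i t)) (∫ t in T, h t))
    (p : ℕ) (h : (Fin r → ℝ) → ℝ) (hh : Continuous h) :
    HasSum (fun i : Fin p → I => (∏ n, ∏ k, α (i k) n) * ∫ t in T, h (mwComp γ i t))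
      (∫ t in T, h t) := by
  have hV : 0 < volume.real T := ENNReal.toReal_pos hTpos.ne' hTc.measure_lt_top.ne
  induction p generalizing h with
  | zero =>
    simp [mwComp]
  | succ p ih =>
    have hw₁ : Summable fun i => ∏ n, α i n := by
      have := (hstep (fun _ => 1) continuous_const).summable
      simpa [summable_mul_right_iff hV.ne'] using this
    have hwp : Summable fun i : Fin p → I => ∏ n, ∏ k, α (i k) n := by
      have := (ih (fun _ => 1) continuous_const).summable
      simpa [summable_mul_right_iff hV.ne'] using this
    rw [← (Fin.consEquiv fun _ : Fin (p + 1) => I).hasSum_iff]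
    set F : I × (Fin p → I) → ℝ := fun ji => (∏ n, α ji.1 n) *
      ((∏ n, ∏ k, α (ji.2 k) n) * ∫ t in T, h (γ ji.1 (mwComp γ ji.2 t)))
    have hF : (fun i : Fin (p + 1) → I => (∏ n, ∏ k, α (i k) n) *
        ∫ t in T, h (mwComp γ i t)) ∘ (Fin.consEquiv fun _ : Fin (p + 1) => I) = F := by
      funext ji
      simp [F, Fin.consEquiv, mwComp_cons, Fin.prod_univ_succ, Finset.prod_mul_distrib, mul_assoc]
    rw [hF]
    have hsum : Summable F := by
      obtain ⟨C, hC⟩ := hTc.exists_bound_of_continuousOn hh.continuousOn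
      refine Summable.of_norm_bounded (g := fun ji => ((∏ n, α ji.1 n) *
        (∏ n, ∏ k, α (ji.2 k) n)) * (C * volume.real T)) ?_ ?_
      · have hprod := hw₁.mul_of_nonneg hwp
          (fun i => Finset.prod_nonneg fun n _ => (hα i n).le)
          (fun i => Finset.prod_nonneg fun n _ => Finset.prod_nonneg fun k _ => (hα (i k) n).le)
        exact hprod.mul_right _
      · rintro ⟨j, i⟩
        have h1 : 0 ≤ ∏ n, α j n := Finset.prod_nonneg fun n _ => (hα j n).le
        have h2 : 0 ≤ ∏ n, ∏ k, α (i k) n :=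
          Finset.prod_nonneg fun n _ => Finset.prod_nonneg fun k _ => (hα _ n).le
        simp only [F]
        rw [← mul_assoc, norm_mul, Real.norm_of_nonneg (mul_nonneg h1 h2)]
        refine mul_le_mul_of_nonneg_left ?_ (mul_nonneg h1 h2)
        exact norm_setIntegral_le_of_norm_le_const hTc.measure_lt_top
          fun t ht => hC _ (hmaps _ _ (mwComp_mem hmaps _ ht))
    have hfib := hsum.hasSum.prod_fiberwise (g := fun j => (∏ n, α j n) * ∫ t in T, h (γ j t))
      fun j => (ih (fun t => h (γ j t)) (hh.comp (hγc j))).mul_left _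
    rw [(hstep h hh).unique hfib]
    exact hsum.hasSum

/-- quantitative estimate
`|𝕄^p f(x) − (1/μ(T))(∫_T ∂_N f dμ) ∏_n x_n| ≤ 2 (∏_n |x_n|) ω_T(∂_N f, r_x q^p)`
with `r_x = max (diam T) ‖x‖` (Euclidean norm/diameter). -/
theorem stmt10 {r : ℕ} (hr : 0 < r) {I : Type*} [Countable I] [Nontrivial I]
    (α a : I → Fin r → ℝ) (q : ℝ)
    (hα : ∀ i n, 0 < α i n ∧ α i n < 1)
    (hqb : ∀ i n, α i n ≤ q) (hq1 : q < 1)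
    (γ : I → (Fin r → ℝ) → (Fin r → ℝ))
    (hγ : ∀ i x n, γ i x n = α i n * x n + a i n)
    (T : Set (Fin r → ℝ)) (hTc : IsCompact T)
    (hT0 : (0 : Fin r → ℝ) ∈ T)
    (hTadm : ∀ x ∈ T, ∀ i, mwPi (γ i 0) (γ i x) ⊆ T)
    (hTpos : 0 < volume T)
    (hdisj : ∀ i j : I, i ≠ j → volume (γ i '' T ∩ γ j '' T) = 0)
    (hsymm : volume (symmDiff T (⋃ i, γ i '' T)) = 0)
    (hclos : T = closure (⋃ i, γ i '' T))
    (f : (Fin r → ℝ) → ℝ) (hf : mwIsCN f)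
    (p : ℕ) (hp : 1 ≤ p) (x : Fin r → ℝ) :
    Summable (fun i : Fin p → I =>
      |mwBoxIncr f (mwComp γ i 0) (mwComp γ i x)|) ∧
    |mwMWp γ f p x - (volume T).toReal⁻¹ * (∫ t in T, mwDN f t) * ∏ n, x n| ≤
      2 * (∏ n, |x n|) * mwOmega T (mwDN f) (max (mwDiam T) (mwNorm x) * q ^ p) := by
  have hq0 : 0 < q := by
    obtain ⟨i⟩ : Nonempty I := inferInstance
    exact (hα i ⟨0, hr⟩).1.trans_le (hqb i ⟨0, hr⟩)
  have hγc : ∀ i, Continuous (γ i) := by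
    intro i
    refine continuous_pi fun n => ?_
    simp only [hγ]
    fun_prop
  have hmaps : ∀ i, ∀ x ∈ T, γ i x ∈ T := fun i x hx => hTadm x hx i fun _ => Or.inr rfl
  have hstep : ∀ h : (Fin r → ℝ) → ℝ, Continuous h →
      HasSum (fun i => (∏ n, α i n) * ∫ t in T, h (γ i t)) (∫ t in T, h t) := by
    intro h hh
    have hint : IntegrableOn h T := hh.continuousOn.integrableOn_compact hTc
    have hU : (⋃ i, γ i '' T) ⊆ T := by
      refine Set.iUnion_subset fun i => ?_
      rintro _ ⟨x, hx, rfl⟩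
      exact hmaps i x hx
    have hs := hasSum_integral_iUnion_ae (μ := volume) (f := h) (s := fun i => γ i '' T)
      (fun i => (hTc.image (hγc i)).measurableSet.nullMeasurableSet)
      (fun i j hij => hdisj i j hij) (hint.mono_set hU)
    rw [← setIntegral_congr_set (measure_symmDiff_eq_zero_iff.1 hsymm)] at hs
    simpa only [setIntegral_image_affine (α _) (a _) (fun n => (hα _ n).1) (hγ _)
      hTc.measurableSet] using hs
  have hself := hasSum_setIntegral_mwComp (fun i n => (hα i n).1) hγc hTc hTpos hmaps hstep p
  have hV : 0 < (volume T).toReal := ENNReal.toReal_pos hTpos.ne' hTc.measure_lt_top.ne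
  obtain ⟨hex, hcont⟩ := hf Finset.univ
  replace hcont : Continuous (mwDN f) := hcont
  set δ := max (mwDiam T) (mwNorm x) * q ^ p with hδ
  have hδ0 : 0 < δ := mul_pos (lt_max_of_lt_left (mwDiam_pos hr hTc hTpos)) (pow_pos hq0 p)
  set ω := mwOmega T (mwDN f) δ
  set w : (Fin p → I) → ℝ := fun i => ∏ n, ∏ k, α (i k) n
  have hw0 : ∀ i, 0 ≤ w i := fun i =>
    Finset.prod_nonneg fun n _ => Finset.prod_nonneg fun k _ => (hα _ n).1.le
  have hw : HasSum w 1 := by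
    have := (hself (fun _ => 1) continuous_const).mul_right (volume T).toReal⁻¹
    simpa [measureReal_def, hV.ne'] using this
  have hA : ∀ (i : Fin p → I) n, |∏ k, α (i k) n| ≤ q ^ p := by
    intro i n
    rw [abs_of_nonneg (Finset.prod_nonneg fun k _ => (hα _ n).1.le)]
    simpa using Finset.prod_le_prod (s := Finset.univ) (g := fun _ => q)
      (fun k _ => (hα (i k) n).1.le) (fun k _ => hqb (i k) n)
  have hb : ∀ i : Fin p → I, mwComp γ i 0 ∈ T := fun i => mwComp_mem hmaps i hT0
  have hosc : ∀ (i : Fin p → I) (y ξ : Fin r → ℝ),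
      mwNorm y ≤ max (mwDiam T) (mwNorm x) →
      (∀ n, ξ n ∈ Set.uIcc (mwComp γ i 0 n) (mwComp γ i y n)) →
      |mwDN f (mwComp γ i 0) - mwDN f ξ| ≤ ω := by
    intro i y ξ hy hξ
    refine abs_sub_le_mwOmega hTc hcont hδ0 (hb i) ?_
    rw [hδ, mul_comm]
    refine (mwNorm_le_mul (v := y) (pow_nonneg hq0.le p) fun n => ?_).trans
      (mul_le_mul_of_nonneg_left hy (pow_nonneg hq0.le p))
    rw [Pi.sub_apply, abs_sub_comm]
    refine (Set.abs_sub_left_of_mem_uIcc (hξ n)).trans ?_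
    rw [mwComp_apply hγ i y n, add_sub_cancel_right, abs_mul]
    exact mul_le_mul_of_nonneg_right (hA i n) (abs_nonneg _)
  have hdist : ∀ (i : Fin p → I), ∀ t ∈ T,
      |mwDN f (mwComp γ i 0) - mwDN f (mwComp γ i t)| ≤ ω := by
    intro i t ht
    refine hosc i t _ (le_max_of_le_left ?_) fun n => Set.right_mem_uIcc
    have h := mwNorm_sub_le_mwDiam hTc ht hT0
    rwa [sub_zero] at h
  have hcompc : ∀ i : Fin p → I, Continuous (mwComp γ i) := by
    intro i
    refine continuous_pi fun n => ?_
    have h : Continuous fun t : Fin r → ℝ => (∏ k, α (i k) n) * t n + mwComp γ i 0 n := by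
      fun_prop
    exact h.congr fun t => (mwComp_apply hγ i t n).symm
  have havg : ∀ i : Fin p → I, |mwDN f (mwComp γ i 0) -
      (volume T).toReal⁻¹ * ∫ t in T, mwDN f (mwComp γ i t)| ≤ ω := by
    intro i
    have hint : IntegrableOn (fun t => mwDN f (mwComp γ i t)) T :=
      (hcont.comp (hcompc i)).continuousOn.integrableOn_compact hTc
    have hconst : IntegrableOn (fun _ : Fin r → ℝ => mwDN f (mwComp γ i 0)) T volume :=
      continuousOn_const.integrableOn_compact hTc
    have hle := norm_setIntegral_le_of_norm_le_const (μ := volume)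
      (f := fun t => mwDN f (mwComp γ i 0) - mwDN f (mwComp γ i t))
      hTc.measure_lt_top fun t ht => hdist i t ht
    rw [integral_sub hconst hint, setIntegral_const, measureReal_def, smul_eq_mul,
      Real.norm_eq_abs] at hle
    have heq : mwDN f (mwComp γ i 0) - (volume T).toReal⁻¹ * ∫ t in T, mwDN f (mwComp γ i t) =
        (volume T).toReal⁻¹ * ((volume T).toReal * mwDN f (mwComp γ i 0) -
          ∫ t in T, mwDN f (mwComp γ i t)) := by
      field_simp
    rw [heq, abs_mul, abs_of_pos (inv_pos.2 hV), inv_mul_le_iff₀ hV]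
    exact hle.trans_eq (mul_comm _ _)
  choose ξ hξ hbox using fun i : Fin p → I => exists_mwBoxIncr_eq hex (mwComp γ i 0) (mwComp γ i x)
  have hbox' : ∀ i : Fin p → I, mwBoxIncr f (mwComp γ i 0) (mwComp γ i x) =
      w i * (∏ n, x n) * mwDN f (ξ i) := by
    intro i
    rw [hbox i]
    congr 1
    simp only [mwComp_apply hγ i x, add_sub_cancel_right, w, Finset.prod_mul_distrib]
  set X := ∏ n, x n
  have hXabs : ∏ n, |x n| = |X| := (Finset.abs_prod _ _).symm
  set G : (Fin p → I) → ℝ := fun i => w i * ∫ t in T, mwDN f (mwComp γ i t)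
  have hG : HasSum (fun i => (volume T).toReal⁻¹ * G i * X)
      ((volume T).toReal⁻¹ * (∫ t in T, mwDN f t) * X) :=
    ((hself (mwDN f) hcont).mul_left _).mul_right _
  have hdiff : ∀ i : Fin p → I, ‖mwBoxIncr f (mwComp γ i 0) (mwComp γ i x) -
      (volume T).toReal⁻¹ * G i * X‖ ≤ w i * (2 * |X| * ω) := by
    intro i
    have heq : mwBoxIncr f (mwComp γ i 0) (mwComp γ i x) - (volume T).toReal⁻¹ * G i * X =
        w i * (X * (mwDN f (ξ i) -
          (volume T).toReal⁻¹ * ∫ t in T, mwDN f (mwComp γ i t))) := by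
      rw [hbox' i]
      simp only [G]
      ring
    have h₁ := hosc i x (ξ i) (le_max_right _ _) (hξ i)
    rw [abs_sub_comm] at h₁
    have h₂ := (abs_sub_le _ _ _).trans (add_le_add h₁ (havg i))
    rw [heq, Real.norm_eq_abs, abs_mul, abs_of_nonneg (hw0 i), abs_mul]
    refine mul_le_mul_of_nonneg_left ?_ (hw0 i)
    nlinarith [mul_le_mul_of_nonneg_left h₂ (abs_nonneg X)]
  have hbd : HasSum (fun i => w i * (2 * |X| * ω)) (2 * |X| * ω) := by
    simpa using hw.mul_right (2 * |X| * ω)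
  have hsumm : Summable fun i : Fin p → I => mwBoxIncr f (mwComp γ i 0) (mwComp γ i x) := by
    simpa using (Summable.of_norm_bounded hbd.summable hdiff).add hG.summable
  refine ⟨hsumm.abs, ?_⟩
  have h := tsum_of_norm_bounded hbd hdiff
  rw [(hsumm.hasSum.sub hG).tsum_eq] at h
  rw [hXabs]
  exact h
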